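/- arXiv:1202.0392 — 2 statements merged into one kernel-verified Lean document; each statement's English description precedes it below -/
import Mathlib

section
/- Let X be a nonzero R-module. The following are equivalent: (1) X is an M-semiprime module; (2) for every submodule N of M and every submodule Y of X, N²·Y = 0 implies N·Y = 0; (3) every nonzero submodule of X is an M-semiprime module; (4) for every nonzero submodule Y of X there exists an M-semiprime module Z with Ann_M(Y) = Ann_M(Z). -/
universe u v

section BeachyDefs

variable (R : Type u) [Ring R]

/-- The Beachy product `N·X`: the smallest submodule `Y` of `X` such that `f(N) = 0`
for every `R`-homomorphism `f : M → X/Y`, i.e. the intersection of all such submodules. -/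
def bprod (M : Type*) [AddCommGroup M] [Module R M]
    (X : Type*) [AddCommGroup X] [Module R X] (N : Submodule R M) : Submodule R X :=
  sInf {Y : Submodule R X | ∀ f : M →ₗ[R] X ⧸ Y, ∀ n ∈ N, f n = 0}

/-- The product `N·Z` for a submodule `Z` of `X`, computed with `Z` regarded as an
`R`-module and viewed as a submodule of `X`. -/
def bprodSub (M : Type*) [AddCommGroup M] [Module R M]
    (X : Type*) [AddCommGroup X] [Module R X] (N : Submodule R M) (Z : Submodule R X) :
    Submodule R X :=
  (bprod R M (↥Z) N).map Z.subtype

/-- `N² := N·N`, a submodule of `M`. -/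
def msq (M : Type*) [AddCommGroup M] [Module R M] (N : Submodule R M) : Submodule R M :=
  bprodSub R M M N N

/-- `Ann_M(X) = ⋂ { ker f : f ∈ Hom_R(M,X) }`, a submodule of `M`. -/
def annM (M : Type*) [AddCommGroup M] [Module R M]
    (X : Type*) [AddCommGroup X] [Module R X] : Submodule R M :=
  ⨅ f : M →ₗ[R] X, LinearMap.ker f

/-- A proper submodule `P` of `X` is `M`-prime if `N·Y ⊆ P` implies `N·X ⊆ P` or `Y ⊆ P`. -/
def IsMPrimeSubmodule (M : Type*) [AddCommGroup M] [Module R M]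
    (X : Type*) [AddCommGroup X] [Module R X] (P : Submodule R X) : Prop :=
  P ≠ ⊤ ∧ ∀ (N : Submodule R M) (Y : Submodule R X),
    bprodSub R M X N Y ≤ P → bprod R M X N ≤ P ∨ Y ≤ P

/-- `X` is an `M`-prime module if `X ≠ 0` and `(0)` is an `M`-prime submodule of `X`. -/
def IsMPrimeModule (M : Type*) [AddCommGroup M] [Module R M]
    (X : Type*) [AddCommGroup X] [Module R X] : Prop :=
  IsMPrimeSubmodule R M X (⊥ : Submodule R X)

/-- A proper submodule `P` of `X` is `M`-semiprime if `N²·Y ⊆ P` implies `N·Y ⊆ P`. -/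
def IsMSemiprimeSubmodule (M : Type*) [AddCommGroup M] [Module R M]
    (X : Type*) [AddCommGroup X] [Module R X] (P : Submodule R X) : Prop :=
  P ≠ ⊤ ∧ ∀ (N : Submodule R M) (Y : Submodule R X),
    bprodSub R M X (msq R M N) Y ≤ P → bprodSub R M X N Y ≤ P

/-- `X` is an `M`-semiprime module if `X ≠ 0` and `(0)` is an `M`-semiprime submodule. -/
def IsMSemiprimeModule (M : Type*) [AddCommGroup M] [Module R M]
    (X : Type*) [AddCommGroup X] [Module R X] : Prop :=
  IsMSemiprimeSubmodule R M X (⊥ : Submodule R X)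

/-- A submodule `N` of `M` is an `M`-ideal if `N = Ann_M(M/N)`. -/
def IsMIdeal (M : Type*) [AddCommGroup M] [Module R M] (N : Submodule R M) : Prop :=
  N = annM R M (M ⧸ N)

/-- The `M`-prime radical `rad_M(X)`: the intersection of all `M`-prime submodules of `X`
(which is all of `X` when there are none). -/
def radM (M : Type*) [AddCommGroup M] [Module R M]
    (X : Type*) [AddCommGroup X] [Module R X] : Submodule R X :=
  sInf {P : Submodule R X | IsMPrimeSubmodule R M X P}

/-- An `M`-m-system in `X`. -/
def IsMmSystem (M : Type*) [AddCommGroup M] [Module R M]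
    (X : Type*) [AddCommGroup X] [Module R X] (S : Set X) : Prop :=
  S.Nonempty ∧ (0 : X) ∉ S ∧
    ∀ (N : Submodule R M) (Y Z : Submodule R X),
      ((↑(Y ⊔ Z) : Set X) ∩ S).Nonempty →
      ((↑(Y ⊔ bprod R M X N) : Set X) ∩ S).Nonempty →
      ((↑(Y ⊔ bprodSub R M X N Z) : Set X) ∩ S).Nonempty

/-- An `M`-n-system in `X`. -/
def IsMnSystem (M : Type*) [AddCommGroup M] [Module R M]
    (X : Type*) [AddCommGroup X] [Module R X] (T : Set X) : Prop :=
  T.Nonempty ∧ (0 : X) ∉ T ∧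
    ∀ (N : Submodule R M) (Y Z : Submodule R X),
      ((↑(Y ⊔ bprodSub R M X N Z) : Set X) ∩ T).Nonempty →
      ((↑(Y ⊔ bprodSub R M X (msq R M N) Z) : Set X) ∩ T).Nonempty

variable (M : Type v) [AddCommGroup M] [Module R M]

/-- A proper `M`-ideal `P` is a prime `M`-ideal if `P = Ann_M(X)` for some `M`-prime module. -/
def IsPrimeMIdeal (P : Submodule R M) : Prop :=
  IsMIdeal R M P ∧ P ≠ ⊤ ∧
    ∃ (X : Type v) (_ : AddCommGroup X) (_ : Module R X),
      IsMPrimeModule R M X ∧ P = annM R M X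

/-- `X` is Beachy-`M`-prime if `Hom_R(M,X) ≠ 0` and `Ann_M(Y) = Ann_M(X)` for every
submodule `Y ⊆ X` with `Hom_R(M,Y) ≠ 0`. -/
def IsBeachyMPrimeModule (X : Type v) [AddCommGroup X] [Module R X] : Prop :=
  (∃ f : M →ₗ[R] X, f ≠ 0) ∧
    ∀ Y : Submodule R X, (∃ g : M →ₗ[R] ↥Y, g ≠ 0) → annM R M (↥Y) = annM R M X

/-- A proper `M`-ideal `P` is a Beachy-prime `M`-ideal if `P = Ann_M(X)` for some
Beachy-`M`-prime module `X`. -/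
def IsBeachyPrimeMIdeal (P : Submodule R M) : Prop :=
  IsMIdeal R M P ∧ P ≠ ⊤ ∧
    ∃ (X : Type v) (_ : AddCommGroup X) (_ : Module R X),
      IsBeachyMPrimeModule R M X ∧ P = annM R M X

/-- An `M`-ideal `P` is primitive if `P = Ann_M(S)` for some simple module `S`. -/
def IsPrimitiveMIdeal (P : Submodule R M) : Prop :=
  IsMIdeal R M P ∧
    ∃ (S : Type v) (_ : AddCommGroup S) (_ : Module R S),
      IsSimpleModule R S ∧ P = annM R M S

/-- The prime radical `P(M)`: the intersection of all prime `M`-ideals of `M`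
(all of `M` when there are none). -/
def primeRadM : Submodule R M := sInf {P : Submodule R M | IsPrimeMIdeal R M P}

/-- `X` belongs to `σ[M]`: `X` embeds in a quotient of a direct sum of copies of `M`. -/
def MemSigma (X : Type v) [AddCommGroup X] [Module R X] : Prop :=
  ∃ (ι : Type v) (K : Submodule R (ι →₀ M)) (g : X →ₗ[R] (ι →₀ M) ⧸ K),
    Function.Injective g

/-- `M` is projective in `σ[M]`. -/
def IsProjInSigma : Prop :=
  ∀ (A : Type v) [AddCommGroup A] [Module R A] (B : Type v) [AddCommGroup B] [Module R B],
    MemSigma R M A → MemSigma R M B →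
      ∀ (g : A →ₗ[R] B), Function.Surjective g →
        ∀ f : M →ₗ[R] B, ∃ h : M →ₗ[R] A, g.comp h = f

/-- `X` is a homogeneous semisimple module: a direct sum of mutually isomorphic
simple modules. -/
def IsHomogSemisimple (X : Type v) [AddCommGroup X] [Module R X] : Prop :=
  ∃ (S : Type v) (_ : AddCommGroup S) (_ : Module R S) (ι : Type v),
    IsSimpleModule R S ∧ Nonempty (X ≃ₗ[R] (ι →₀ S))

end BeachyDefs

theorem mem_annM_iff (R : Type*) [Ring R] (M : Type*) [AddCommGroup M] [Module R M]
    (X : Type*) [AddCommGroup X] [Module R X] (m : M) :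
    m ∈ annM R M X ↔ ∀ f : M →ₗ[R] X, f m = 0 := by
  simp [annM, Submodule.mem_iInf]

theorem bprod_eq_bot_iff (R : Type*) [Ring R] (M : Type*) [AddCommGroup M] [Module R M]
    (X : Type*) [AddCommGroup X] [Module R X] (N : Submodule R M) :
    bprod R M X N = ⊥ ↔ N ≤ annM R M X := by
  constructor
  · intro h n hn
    rw [mem_annM_iff]
    intro f
    rw [← Submodule.mem_bot R, ← h, bprod, Submodule.mem_sInf]
    intro Y hY
    have := hY (Y.mkQ.comp f) n hn
    simpa using this
  · intro h
    rw [eq_bot_iff]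
    refine sInf_le ?_
    intro f n hn
    have := (mem_annM_iff R M X n).1 (h hn)
      ((Submodule.quotEquivOfEqBot (⊥ : Submodule R X) rfl).toLinearMap.comp f)
    simpa using this

theorem bprodSub_eq_bot_iff (R : Type*) [Ring R] (M : Type*) [AddCommGroup M] [Module R M]
    (X : Type*) [AddCommGroup X] [Module R X] (N : Submodule R M) (Y : Submodule R X) :
    bprodSub R M X N Y = ⊥ ↔ N ≤ annM R M Y := by
  rw [← bprod_eq_bot_iff, bprodSub, ← le_bot_iff, Submodule.map_le_iff_le_comap,
    Submodule.comap_bot, Submodule.ker_subtype, le_bot_iff]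

theorem annM_congr (R : Type*) [Ring R] (M : Type*) [AddCommGroup M] [Module R M]
    (X : Type*) [AddCommGroup X] [Module R X] (Y : Type*) [AddCommGroup Y] [Module R Y]
    (e : X ≃ₗ[R] Y) : annM R M X = annM R M Y := by
  ext m
  rw [mem_annM_iff, mem_annM_iff]
  constructor
  · intro h f
    simpa using h (e.symm.toLinearMap.comp f)
  · intro h f
    simpa using h (e.toLinearMap.comp f)

theorem isMSemiprimeModule_iff_annM (R : Type*) [Ring R] (M : Type*) [AddCommGroup M] [Module R M]
    (X : Type*) [AddCommGroup X] [Module R X] :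
    IsMSemiprimeModule R M X ↔ Nontrivial X ∧ ∀ (N : Submodule R M) (Y : Submodule R X),
      msq R M N ≤ annM R M Y → N ≤ annM R M Y := by
  simp only [IsMSemiprimeModule, IsMSemiprimeSubmodule, le_bot_iff, bprodSub_eq_bot_iff]
  rw [← Submodule.nontrivial_iff R]
  exact and_congr_left' ⟨fun h => ⟨⟨_, _, h⟩⟩, fun _ => bot_ne_top⟩

/-- Proposition 2.18: characterizations of `M`-semiprime modules. -/
theorem isMSemiprimeModule_tfae (R : Type u) [Ring R]
    (M : Type v) [AddCommGroup M] [Module R M]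
    (X : Type v) [AddCommGroup X] [Module R X] (hX : Nontrivial X) :
    (IsMSemiprimeModule R M X ↔
      ∀ (N : Submodule R M) (Y : Submodule R X),
        bprodSub R M X (msq R M N) Y = ⊥ → bprodSub R M X N Y = ⊥) ∧
    (IsMSemiprimeModule R M X ↔
      ∀ Y : Submodule R X, Y ≠ ⊥ → IsMSemiprimeModule R M (↥Y)) ∧
    (IsMSemiprimeModule R M X ↔
      ∀ Y : Submodule R X, Y ≠ ⊥ →
        ∃ (Z : Type v) (_ : AddCommGroup Z) (_ : Module R Z),
          IsMSemiprimeModule R M Z ∧ annM R M (↥Y) = annM R M Z) := by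
  have h3 : IsMSemiprimeModule R M X →
      ∀ Y : Submodule R X, Y ≠ ⊥ → IsMSemiprimeModule R M (↥Y) := by
    intro h Y hY
    rw [isMSemiprimeModule_iff_annM] at h ⊢
    refine ⟨(Submodule.nontrivial_iff_ne_bot).2 hY, fun N W hW => ?_⟩
    have e := annM_congr R M _ _ (Submodule.equivMapOfInjective Y.subtype Y.injective_subtype W)
    rw [e] at hW ⊢
    exact h.2 N _ hW
  have h4 : (∀ Y : Submodule R X, Y ≠ ⊥ →
        ∃ (Z : Type v) (_ : AddCommGroup Z) (_ : Module R Z),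
          IsMSemiprimeModule R M Z ∧ annM R M (↥Y) = annM R M Z) →
      IsMSemiprimeModule R M X := by
    intro h
    rw [isMSemiprimeModule_iff_annM]
    refine ⟨hX, fun N Y hN => ?_⟩
    by_cases hY : Y = ⊥
    · subst hY
      intro n _
      rw [mem_annM_iff]
      intro f
      exact Subsingleton.elim _ _
    · obtain ⟨Z, _, _, hZ, e⟩ := h Y hY
      rw [isMSemiprimeModule_iff_annM] at hZ
      have e' := annM_congr R M _ _ (Submodule.topEquiv (R := R) (M := Z))
      rw [e, ← e'] at hN ⊢
      exact hZ.2 N _ hN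
  refine ⟨?_, ⟨h3, fun h => h4 fun Y hY => ⟨Y, _, _, h Y hY, rfl⟩⟩,
    ⟨fun h Y hY => ⟨Y, _, _, h3 h Y hY, rfl⟩, h4⟩⟩
  rw [isMSemiprimeModule_iff_annM]
  simp only [bprodSub_eq_bot_iff]
  exact ⟨fun h => h.2, fun h => ⟨hX, h⟩⟩
end

section
/- Assume M is projective in σ[M] and let X be a module in σ[M]. Then every M-prime submodule of X is an M-semiprime submodule of X. -/
universe u v

section Helpers

variable {R : Type u} [Ring R] {M : Type v} [AddCommGroup M] [Module R M]

theorem MemSigma.of_injective {X Y : Type v} [AddCommGroup X] [Module R X]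
    [AddCommGroup Y] [Module R Y] (hX : MemSigma R M X) (j : Y →ₗ[R] X)
    (hj : Function.Injective j) : MemSigma R M Y := by
  obtain ⟨ι, K, g, hg⟩ := hX
  exact ⟨ι, K, g.comp j, hg.comp hj⟩

theorem MemSigma.quot {X : Type v} [AddCommGroup X] [Module R X]
    (hX : MemSigma R M X) (Z : Submodule R X) : MemSigma R M (X ⧸ Z) := by
  obtain ⟨ι, K, g, hg⟩ := hX
  have hle : K ≤ (Z.map g).comap K.mkQ := by
    intro x hx
    have : K.mkQ x = 0 := by simpa using hx
    rw [Submodule.mem_comap, this]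
    exact zero_mem _
  let q : ((ι →₀ M) ⧸ K) →ₗ[R] (ι →₀ M) ⧸ ((Z.map g).comap K.mkQ) :=
    Submodule.mapQ K _ LinearMap.id hle
  have hq : ∀ y, q y = 0 ↔ y ∈ Z.map g := by
    intro y
    obtain ⟨x, rfl⟩ := K.mkQ_surjective y
    simp only [q, Submodule.mkQ_apply, Submodule.mapQ_apply, LinearMap.id_apply,
      Submodule.Quotient.mk_eq_zero, Submodule.mem_comap]
  refine ⟨ι, (Z.map g).comap K.mkQ, Z.liftQ (q.comp g) ?_, ?_⟩
  · intro z hz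
    rw [LinearMap.mem_ker, LinearMap.comp_apply, hq]
    exact Submodule.mem_map_of_mem hz
  · rw [← LinearMap.ker_eq_bot, LinearMap.ker_eq_bot']
    intro y hy
    obtain ⟨x, rfl⟩ := Z.mkQ_surjective y
    rw [Submodule.mkQ_apply, Submodule.liftQ_apply, LinearMap.comp_apply, hq] at hy
    obtain ⟨z, hz, hzx⟩ := hy
    rw [Submodule.mkQ_apply, Submodule.Quotient.mk_eq_zero, ← hg hzx]
    exact hz

theorem map_mem_bprod {X : Type v} [AddCommGroup X] [Module R X] (N : Submodule R M)
    (f : M →ₗ[R] X) {n : M} (hn : n ∈ N) : f n ∈ bprod R M X N := by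
  rw [bprod, Submodule.mem_sInf]
  intro Y hY
  have := hY (Y.mkQ.comp f) n hn
  simpa using this

theorem map_mem_bprodSub {X : Type v} [AddCommGroup X] [Module R X] (N : Submodule R M)
    (Y : Submodule R X) (f : M →ₗ[R] Y) {n : M} (hn : n ∈ N) :
    (f n : X) ∈ bprodSub R M X N Y :=
  Submodule.mem_map_of_mem (f := Y.subtype) (map_mem_bprod N f hn)

theorem bprod_le (hproj : IsProjInSigma R M) {X : Type v} [AddCommGroup X] [Module R X]
    (hX : MemSigma R M X) (N : Submodule R M) (Z : Submodule R X)
    (h : ∀ f : M →ₗ[R] X, ∀ n ∈ N, f n ∈ Z) : bprod R M X N ≤ Z := by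
  refine sInf_le ?_
  intro f n hn
  obtain ⟨k, rfl⟩ := hproj X (X ⧸ Z) hX (hX.quot Z) Z.mkQ Z.mkQ_surjective f
  simpa using h k n hn

theorem bprodSub_le (hproj : IsProjInSigma R M) {X : Type v} [AddCommGroup X] [Module R X]
    (hX : MemSigma R M X) (N : Submodule R M) (Y Z : Submodule R X)
    (h : ∀ f : M →ₗ[R] Y, ∀ n ∈ N, (f n : X) ∈ Z) : bprodSub R M X N Y ≤ Z := by
  rw [bprodSub, Submodule.map_le_iff_le_comap]
  exact bprod_le hproj (hX.of_injective Y.subtype Y.subtype_injective) N _ h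

theorem bprodSub_bprodSub_le (hproj : IsProjInSigma R M) {X : Type v} [AddCommGroup X]
    [Module R X] (hX : MemSigma R M X) (N : Submodule R M) (Y : Submodule R X) :
    bprodSub R M X N (bprodSub R M X N Y) ≤ bprodSub R M X (msq R M N) Y := by
  refine bprodSub_le hproj hX _ _ _ ?_
  intro g n hn
  let c : (M →ₗ[R] Y) → (N →ₗ[R] (bprodSub R M X N Y)) := fun f =>
    ((Y.subtype.comp f).comp N.subtype).codRestrict _
      (fun m => map_mem_bprodSub N Y f m.2)
  let φ : ((M →ₗ[R] Y) →₀ N) →ₗ[R] (bprodSub R M X N Y) := Finsupp.lsum ℕ c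
  have hφ : Function.Surjective φ := by
    have hle : bprodSub R M X N Y ≤ (LinearMap.range φ).map (Submodule.subtype _) := by
      refine bprodSub_le hproj hX _ _ _ ?_
      intro f m hm
      refine ⟨c f ⟨m, hm⟩, ⟨Finsupp.single f ⟨m, hm⟩, ?_⟩, rfl⟩
      simp [φ]
    intro w
    obtain ⟨w', ⟨a, ha⟩, hw⟩ := hle w.2
    exact ⟨a, ha.trans (Subtype.ext hw)⟩
  have hA : MemSigma R M ((M →ₗ[R] Y) →₀ N) := by
    refine ⟨M →ₗ[R] Y, ⊥, (Submodule.mkQ ⊥).comp (Finsupp.mapRange.linearMap N.subtype), ?_⟩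
    refine Function.Injective.comp (g := (Submodule.mkQ ⊥)) ?_ ?_
    · rw [← LinearMap.ker_eq_bot, Submodule.ker_mkQ]
    · exact Finsupp.mapRange_injective _ rfl N.subtype_injective
  obtain ⟨h, rfl⟩ := hproj _ _ hA
    (hX.of_injective (bprodSub R M X N Y).subtype (Submodule.subtype_injective _)) φ hφ g
  have : ((φ (h n) : bprodSub R M X N Y) : X)
      = (h n).sum (fun f m => ((f (m : M) : Y) : X)) := by
    simp only [φ, Finsupp.lsum_apply, Finsupp.sum, AddSubmonoidClass.coe_finset_sum]
    rfl
  rw [LinearMap.comp_apply, this]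
  refine Submodule.sum_mem _ ?_
  intro f _
  refine map_mem_bprodSub _ Y f ?_
  exact map_mem_bprodSub N N ((Finsupp.lapply f).comp h) hn

end Helpers

/-- Proposition 2.24: if `M` is projective in `σ[M]` and `X ∈ σ[M]`, then
every `M`-prime submodule of `X` is `M`-semiprime. -/
theorem isMSemiprime_of_isMPrime (R : Type u) [Ring R]
    (M : Type v) [AddCommGroup M] [Module R M] (hproj : IsProjInSigma R M)
    (X : Type v) [AddCommGroup X] [Module R X] (hX : MemSigma R M X)
    (P : Submodule R X) (hP : IsMPrimeSubmodule R M X P) :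
    IsMSemiprimeSubmodule R M X P := by
  refine ⟨hP.1, fun N Y h => ?_⟩
  rcases hP.2 N _ ((bprodSub_bprodSub_le hproj hX N Y).trans h) with h1 | h1
  · refine le_trans (bprodSub_le hproj hX N Y _ ?_) h1
    intro f n hn
    exact map_mem_bprod N (Y.subtype.comp f) hn
  · exact h1
end
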